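/- Hacking without exploitation: fix finite S, any finite A with at least two distinct actions a_1 ≠ a_2, any initial distribution d0, and any γ ∈ (0,1). Let R(s,a) = 1{a = a_1} and R'(s,a) = 1{a = a_2}, let π be the policy always selecting a_1 and π' the policy always selecting a_2. Then: (i) for EVERY transition model T, J_{T,R}(π) = 1/(1−γ), J_{T,R}(π') = 0, J_{T,R'}(π') = 1/(1−γ), and J_{T,R'}(π) = 0; hence (ii) for every T, the pair (R, R') is hackable on {π, π'} in the environment with transition model T; and (iii) for every pair of transition models (T, T') and for each of the rewards R and R', the pair (T, T') is unexploitable on {π, π'}: the strict ordering of π over π' under R (and of π' over π under R') is the same under every transition model. -/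

import Mathlib

open Matrix

/-- `p` is a probability distribution on the finite set `S`. -/
def IsDist {S : Type*} [Fintype S] (p : S → ℝ) : Prop :=
  (∀ s, 0 ≤ p s) ∧ ∑ s, p s = 1

/-- `π` is a stationary policy: each `π s` is a distribution over actions. -/
def IsPolicy {S A : Type*} [Fintype A] (π : S → A → ℝ) : Prop :=
  ∀ s, (∀ a, 0 ≤ π s a) ∧ ∑ a, π s a = 1

/-- `T` is a transition model: each `T s a` is a distribution over next states. -/
def IsTransModel {S A : Type*} [Fintype S] (T : S → A → S → ℝ) : Prop :=
  ∀ s a, (∀ s', 0 ≤ T s a s') ∧ ∑ s', T s a s' = 1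

/-- The policy-induced transition matrix `P^π(s,s') = Σ_a π(a|s) T(s'|s,a)`. -/
noncomputable def Pmat {S A : Type*} [Fintype A] (T : S → A → S → ℝ)
    (π : S → A → ℝ) : Matrix S S ℝ :=
  Matrix.of fun s s' => ∑ a, π s a * T s a s'

/-- The policy-induced expected reward vector `r^π(s) = Σ_a π(a|s) R(s,a)`. -/
noncomputable def rvec {S A : Type*} [Fintype A] (R : S → A → ℝ)
    (π : S → A → ℝ) : S → ℝ :=
  fun s => ∑ a, π s a * R s a

/-- The policy value `J(π) = Σ_s d0(s) V^π(s)` with `V^π = (I - γ P^π)⁻¹ r^π`. -/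
noncomputable def Jval {S A : Type*} [Fintype S] [Fintype A] [DecidableEq S]
    (T : S → A → S → ℝ) (R : S → A → ℝ) (d0 : S → ℝ) (γ : ℝ)
    (π : S → A → ℝ) : ℝ :=
  ∑ s, d0 s * (((1 : Matrix S S ℝ) - γ • Pmat T π)⁻¹ *ᵥ rvec R π) s

/-- Discounted visit counts `F^π(s,a) = μ^π(s) π(a|s)` with
`μ^π = (I - γ (P^π)ᵀ)⁻¹ d0`. -/
noncomputable def visitCount {S A : Type*} [Fintype S] [Fintype A] [DecidableEq S]
    (T : S → A → S → ℝ) (d0 : S → ℝ) (γ : ℝ) (π : S → A → ℝ) :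
    S → A → ℝ :=
  fun s a => ((((1 : Matrix S S ℝ) - γ • (Pmat T π)ᵀ)⁻¹) *ᵥ d0) s * π s a

/-- The policy value written as the inner product `J(π) = ⟨R, F^π⟩`. -/
noncomputable def JvisF {S A : Type*} [Fintype S] [Fintype A] [DecidableEq S]
    (T : S → A → S → ℝ) (R : S → A → ℝ) (d0 : S → ℝ) (γ : ℝ)
    (π : S → A → ℝ) : ℝ :=
  ∑ s, ∑ a, R s a * visitCount T d0 γ π s a

/-- The interior `Π⁺` of the policy space: policies with all entries positive. -/
def PiPlus {S A : Type*} [Fintype A] : Set (S → A → ℝ) :=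
  {π | IsPolicy π ∧ ∀ s a, 0 < π s a}

/-- The transition matrix of a policy is entrywise nonnegative. -/
lemma Pmat_nonneg {S A : Type*} [Fintype S] [Fintype A] {T : S → A → S → ℝ}
    (hT : IsTransModel T) {π : S → A → ℝ} (hπ : IsPolicy π) (s s' : S) :
    0 ≤ Pmat T π s s' :=
  Finset.sum_nonneg fun a _ => mul_nonneg ((hπ s).1 a) ((hT s a).1 s')

/-- The rows of the transition matrix of a policy sum to one. -/
lemma sum_Pmat {S A : Type*} [Fintype S] [Fintype A] {T : S → A → S → ℝ}
    (hT : IsTransModel T) {π : S → A → ℝ} (hπ : IsPolicy π) (s : S) :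
    ∑ s', Pmat T π s s' = 1 := by
  simp only [Pmat, Matrix.of_apply]
  rw [Finset.sum_comm]
  simp only [← Finset.mul_sum, (hT s _).2, mul_one, (hπ s).2]

/-- `I - γ P^π` is strictly diagonally dominant, hence invertible. -/
lemma isUnit_det_one_sub_smul_Pmat {S A : Type*} [Fintype S] [Fintype A] [DecidableEq S]
    {T : S → A → S → ℝ} (hT : IsTransModel T) {π : S → A → ℝ} (hπ : IsPolicy π)
    {γ : ℝ} (hγ0 : 0 ≤ γ) (hγ1 : γ < 1) :
    IsUnit ((1 : Matrix S S ℝ) - γ • Pmat T π).det := by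
  rw [isUnit_iff_ne_zero]
  refine det_ne_zero_of_sum_row_lt_diag fun k => ?_
  have hoff : ∑ j ∈ Finset.univ.erase k, ‖((1 : Matrix S S ℝ) - γ • Pmat T π) k j‖ =
      γ * ∑ j ∈ Finset.univ.erase k, Pmat T π k j := by
    rw [Finset.mul_sum]
    refine Finset.sum_congr rfl fun j hj => ?_
    have hkj : k ≠ j := (Finset.ne_of_mem_erase hj).symm
    simp [Matrix.one_apply_ne hkj, abs_of_nonneg hγ0, abs_of_nonneg (Pmat_nonneg hT hπ k j)]
  have hsum := Finset.add_sum_erase Finset.univ (Pmat T π k) (Finset.mem_univ k)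
  rw [sum_Pmat hT hπ k] at hsum
  rw [hoff, Real.norm_eq_abs]
  refine lt_of_lt_of_le ?_ (le_abs_self _)
  simp only [Matrix.sub_apply, Matrix.one_apply_eq, Matrix.smul_apply, smul_eq_mul]
  rw [← eq_sub_iff_add_eq'] at hsum
  rw [hsum]
  linarith

/-- A policy whose expected reward is the constant `c` has value `c / (1 - γ)`. -/
lemma Jval_eq_of_rvec_const {S A : Type*} [Fintype S] [Fintype A] [DecidableEq S]
    {T : S → A → S → ℝ} (hT : IsTransModel T) {R : S → A → ℝ} {d0 : S → ℝ} (hd0 : IsDist d0)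
    {γ : ℝ} (hγ0 : 0 ≤ γ) (hγ1 : γ < 1) {π : S → A → ℝ} (hπ : IsPolicy π) {c : ℝ}
    (hc : rvec R π = fun _ => c) : Jval T R d0 γ π = c / (1 - γ) := by
  have hγ : 1 - γ ≠ 0 := by linarith
  have hmul : rvec R π = ((1 : Matrix S S ℝ) - γ • Pmat T π) *ᵥ fun _ => c / (1 - γ) := by
    rw [hc, Matrix.sub_mulVec, Matrix.one_mulVec, Matrix.smul_mulVec]
    funext s
    simp only [Pi.sub_apply, Pi.smul_apply, smul_eq_mul, Matrix.mulVec, dotProduct,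
      ← Finset.sum_mul, sum_Pmat hT hπ s]
    field_simp
  rw [Jval, hmul, Matrix.mulVec_mulVec,
    Matrix.nonsing_inv_mul _ (isUnit_det_one_sub_smul_Pmat hT hπ hγ0 hγ1), Matrix.one_mulVec,
    ← Finset.sum_mul, hd0.2, one_mul]

/-- Always playing the action `b` is a policy. -/
lemma isPolicy_const_action {S A : Type*} [Fintype A] [DecidableEq A] (b : A) :
    IsPolicy (fun (_ : S) a => if a = b then (1 : ℝ) else 0) :=
  fun _ => ⟨fun a => by dsimp only; split_ifs <;> norm_num, by simp⟩

/-- The expected reward of always playing `b` is the reward of `b`. -/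
lemma rvec_const_action {S A : Type*} [Fintype A] [DecidableEq A] (R : S → A → ℝ) (b : A) :
    rvec R (fun _ a => if a = b then (1 : ℝ) else 0) = fun s => R s b := by
  funext s
  simp [rvec]

/-- **Hacking without exploitation**: with `R = 1{a = a₁}`, `R' = 1{a = a₂}`,
`π` always playing `a₁` and `π'` always playing `a₂`: (i) the four values are
as computed for every transition model; (ii) `(R, R')` is hackable on `{π, π'}`
in every environment; (iii) for every pair of transition models `(T, T')` and
each of the two rewards, `(T, T')` is unexploitable on `{π, π'}`. -/
theorem stmt19 {S A : Type*} [Fintype S] [Fintype A] [DecidableEq S]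
    [DecidableEq A] [Nonempty S]
    (hA : 1 < Fintype.card A) (a₁ a₂ : A) (hne : a₁ ≠ a₂)
    (d0 : S → ℝ) (hd0 : IsDist d0)
    (γ : ℝ) (hγ0 : 0 < γ) (hγ1 : γ < 1)
    (R R' : S → A → ℝ)
    (hR : R = fun _ a => if a = a₁ then 1 else 0)
    (hR' : R' = fun _ a => if a = a₂ then 1 else 0)
    (π π' : S → A → ℝ)
    (hπ : π = fun _ a => if a = a₁ then 1 else 0)
    (hπ' : π' = fun _ a => if a = a₂ then 1 else 0) :
    -- (i) the values under every transition model
    (∀ T : S → A → S → ℝ, IsTransModel T →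
      Jval T R d0 γ π = 1 / (1 - γ) ∧ Jval T R d0 γ π' = 0 ∧
      Jval T R' d0 γ π' = 1 / (1 - γ) ∧ Jval T R' d0 γ π = 0) ∧
    -- (ii) `(R, R')` is hackable on `{π, π'}` in every environment
    (∀ T : S → A → S → ℝ, IsTransModel T →
      ∃ σ ∈ ({π, π'} : Set (S → A → ℝ)), ∃ σ' ∈ ({π, π'} : Set (S → A → ℝ)),
        Jval T R d0 γ σ' < Jval T R d0 γ σ ∧
        Jval T R' d0 γ σ < Jval T R' d0 γ σ') ∧
    -- (iii) `(T, T')` is unexploitable on `{π, π'}` for each of `R` and `R'`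
    (∀ T T' : S → A → S → ℝ, IsTransModel T → IsTransModel T' →
      (¬ ∃ σ ∈ ({π, π'} : Set (S → A → ℝ)), ∃ σ' ∈ ({π, π'} : Set (S → A → ℝ)),
        Jval T R d0 γ σ' < Jval T R d0 γ σ ∧
        Jval T' R d0 γ σ < Jval T' R d0 γ σ') ∧
      (¬ ∃ σ ∈ ({π, π'} : Set (S → A → ℝ)), ∃ σ' ∈ ({π, π'} : Set (S → A → ℝ)),
        Jval T R' d0 γ σ' < Jval T R' d0 γ σ ∧
        Jval T' R' d0 γ σ < Jval T' R' d0 γ σ')) := by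
  have hval : ∀ T : S → A → S → ℝ, IsTransModel T →
      Jval T R d0 γ π = 1 / (1 - γ) ∧ Jval T R d0 γ π' = 0 ∧
      Jval T R' d0 γ π' = 1 / (1 - γ) ∧ Jval T R' d0 γ π = 0 := by
    intro T hT
    have key : ∀ b c : A, Jval T (fun _ a => if a = b then 1 else 0) d0 γ
        (fun _ a => if a = c then 1 else 0) = (if c = b then 1 else 0) / (1 - γ) := fun b c =>
      Jval_eq_of_rvec_const hT hd0 hγ0.le hγ1 (isPolicy_const_action c) (rvec_const_action _ c)
    subst hR hR' hπ hπ'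
    simp only [key, if_neg hne, if_neg hne.symm, if_true, zero_div, and_self]
  have hpos : 0 < 1 / (1 - γ) := one_div_pos.2 (by linarith)
  refine ⟨hval, fun T hT => ?_, fun T T' hT hT' => ?_⟩
  · obtain ⟨h₁, h₂, h₃, h₄⟩ := hval T hT
    exact ⟨π, by simp, π', by simp, by rwa [h₁, h₂], by rwa [h₃, h₄]⟩
  · obtain ⟨h₁, h₂, h₃, h₄⟩ := hval T hT
    obtain ⟨k₁, k₂, k₃, k₄⟩ := hval T' hT'
    constructor <;>
    · rintro ⟨σ, rfl | rfl, σ', rfl | rfl, h, h'⟩ <;> linarith
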